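/- Let d ≥ 1 be an integer and θ > 0. There exist constants δ, η > 0, depending only on d and θ, such that the following holds. Let f : [0,∞) → (0,∞) be Lipschitz with f(s) ≤ f(0) = θ for all s ≥ 0 and with Lipschitz constant less than δ; let φ : B₁' → ℝ be of class C^{1,1} with φ(0) = 0, ∇φ(0) = 0, and with the Lipschitz constant of ∇φ less than δ; and let u be continuous on B₁' × [0,1), harmonic in B₁' × (0,1), such that for every x ∈ B₁' the one-sided derivative ∂_y u(x,0) := lim_{t→0⁺}(u(x,t) − u(x,0))/t exists, |∂_y u(x,0)| ≤ θ, and ∂_y u(x,0) = f(|u(x,0) − φ(x)|)·sign(u(x,0) − φ(x)) whenever u(x,0) ≠ φ(x). Assume moreover that: u(x,0) ≤ δ for all x ∈ B₁'; |∂_y u(x,y)| ≤ θ + δy for all (x,y) ∈ B₁' × (0,1); and there exists ẑ ∈ B'_{1/100} with u(ẑ,0) > φ(ẑ). Then ∂_y u(x,η) ≥ θ/2 for every x ∈ ℝ^d with |x| ≤ 1/2. -/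

import Mathlib

open MeasureTheory Set

/-- Euclidean space `ℝ^d`. -/
abbrev Esp (d : ℕ) := EuclideanSpace ℝ (Fin d)

/-- The upper half-ball `B_r⁺ = B_r ∩ {y > 0}` in `ℝ^{d+1} = ℝ^d × ℝ`. -/
def upBall (d : ℕ) (r : ℝ) : Set (Esp d × ℝ) := {p | ‖p.1‖^2 + p.2^2 < r^2 ∧ 0 < p.2}

/-- The thin ball `B_r' = B_r ∩ {y = 0}` in `ℝ^{d+1} = ℝ^d × ℝ`. -/
def flatBall (d : ℕ) (r : ℝ) : Set (Esp d × ℝ) := {p | ‖p.1‖^2 + p.2^2 < r^2 ∧ p.2 = 0}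

/-- Laplacian on `ℝ^d × ℝ`, computed through iterated coordinate derivatives. -/
noncomputable def lapH (d : ℕ) (u : Esp d × ℝ → ℝ) (p : Esp d × ℝ) : ℝ :=
  (∑ i : Fin d,
    deriv (deriv (fun t : ℝ => u (p.1 + t • EuclideanSpace.single i (1:ℝ), p.2))) 0)
  + deriv (deriv (fun t : ℝ => u (p.1, p.2 + t))) 0

/-- `u` is harmonic on the open set `U`: it is `C²` there and its Laplacian vanishes. -/
def HarmonicOnH (d : ℕ) (u : Esp d × ℝ → ℝ) (U : Set (Esp d × ℝ)) : Prop :=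
  ContDiffOn ℝ 2 u U ∧ ∀ p ∈ U, lapH d u p = 0

/-- Vertical partial derivative `∂_y u`. -/
noncomputable def pdy (d : ℕ) (u : Esp d × ℝ → ℝ) (p : Esp d × ℝ) : ℝ :=
  deriv (fun t : ℝ => u (p.1, p.2 + t)) 0

/-- Squared norm of the tangential gradient `|∇_x u|²`. -/
noncomputable def tangGradSq (d : ℕ) (u : Esp d × ℝ → ℝ) (p : Esp d × ℝ) : ℝ :=
  ∑ i : Fin d,
    (deriv (fun t : ℝ => u (p.1 + t • EuclideanSpace.single i (1:ℝ), p.2)) 0)^2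

/-- Squared norm of the full gradient `|∇u|²`. -/
noncomputable def gradSqH (d : ℕ) (u : Esp d × ℝ → ℝ) (p : Esp d × ℝ) : ℝ :=
  tangGradSq d u p + (pdy d u p)^2

/-- `L` is the one-sided vertical derivative `∂_y u(x,0⁺)`. -/
def NormalDeriv (d : ℕ) (u : Esp d × ℝ → ℝ) (x : Esp d) (L : ℝ) : Prop :=
  Filter.Tendsto (fun t => (u (x, t) - u (x, 0)) / t) (nhdsWithin 0 (Set.Ioi 0)) (nhds L)

/-- `f : [0,∞) → (0,∞)` is `L`-Lipschitz with `f ≤ f 0 = θ`. -/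
def GoodF (θ L : ℝ) (f : ℝ → ℝ) : Prop :=
  f 0 = θ ∧ (∀ s : ℝ, 0 ≤ s → 0 < f s ∧ f s ≤ θ) ∧
  (∀ s t : ℝ, 0 ≤ s → 0 ≤ t → |f s - f t| ≤ L * |s - t|)

/-- `u` is a solution of the two-phase thin obstacle problem in `B₁` with nonlinearity `f`
and obstacle `φ`: continuous on `B₁⁺ ∪ B₁'`, harmonic in `B₁⁺`, and on `B₁'` the one-sided
vertical derivative exists, is bounded by `θ` in absolute value, and equals
`f(|u−φ|)·sign(u−φ)` off the contact set. -/
def TwoPhaseSolH (d : ℕ) (θ : ℝ) (f : ℝ → ℝ) (φ : Esp d → ℝ) (u : Esp d × ℝ → ℝ) : Prop :=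
  ContinuousOn u (upBall d 1 ∪ flatBall d 1) ∧
  HarmonicOnH d u (upBall d 1) ∧
  ∀ x : Esp d, ‖x‖ < 1 → ∃ L : ℝ, NormalDeriv d u x L ∧ |L| ≤ θ ∧
    (u (x, 0) ≠ φ x → L = f |u (x, 0) - φ x| * Real.sign (u (x, 0) - φ x))

/-- `φ` is of class `C^{1,1}` on `B₁'` with `C^{1,1}` norm at most `P`. -/
def C11Bound (d : ℕ) (P : ℝ) (φ : Esp d → ℝ) : Prop :=
  (∀ x : Esp d, ‖x‖ < 1 → DifferentiableAt ℝ φ x ∧ |φ x| ≤ P ∧ ‖fderiv ℝ φ x‖ ≤ P) ∧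
  (∀ x y : Esp d, ‖x‖ < 1 → ‖y‖ < 1 → ‖fderiv ℝ φ x - fderiv ℝ φ y‖ ≤ P * ‖x - y‖)

section

/-- The coordinate unit vectors of `ℝ^d × ℝ`. -/
noncomputable def basisDir (d : ℕ) : Option (Fin d) → Esp d × ℝ
  | none => (0, 1)
  | some i => (EuclideanSpace.single i 1, 0)

/-- The coordinate functionals of `ℝ^d × ℝ`. -/
noncomputable def coordH (d : ℕ) : Option (Fin d) → (Esp d × ℝ) →L[ℝ] ℝ
  | none => ContinuousLinearMap.snd ℝ (Esp d) ℝ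
  | some i => (EuclideanSpace.proj i).comp (ContinuousLinearMap.fst ℝ (Esp d) ℝ)

/-- The squared Euclidean distance on `ℝ^d × ℝ`. -/
noncomputable def distSq (d : ℕ) (P p : Esp d × ℝ) : ℝ := ‖p.1 - P.1‖ ^ 2 + (p.2 - P.2) ^ 2

variable {d : ℕ}

theorem coordH_basisDir (o o' : Option (Fin d)) :
    coordH d o (basisDir d o') = if o = o' then 1 else 0 := by
  cases o <;> cases o' <;> simp [coordH, basisDir]

theorem distSq_eq_sum (P p : Esp d × ℝ) : distSq d P p = ∑ o, (coordH d o (p - P)) ^ 2 := by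
  simp [distSq, Fintype.sum_option, coordH, EuclideanSpace.norm_sq_eq, add_comm]

theorem eq_sum_coordH_smul (p : Esp d × ℝ) : p = ∑ o, coordH d o p • basisDir d o := by
  refine Prod.ext ?_ ?_
  · ext j
    simp [Fintype.sum_option, coordH, basisDir, Prod.fst_sum, Pi.single_apply]
  · simp [Fintype.sum_option, coordH, basisDir, Prod.snd_sum]

theorem abs_coordH_le (o : Option (Fin d)) (p : Esp d × ℝ) : |coordH d o p| ≤ ‖p‖ := by
  cases o with
  | none => exact norm_snd_le p
  | some i => exact (PiLp.norm_apply_le p.1 i).trans (norm_fst_le p)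

theorem distSq_nonneg (P p : Esp d × ℝ) : 0 ≤ distSq d P p := by
  unfold distSq; positivity

theorem distSq_add_smul (P p : Esp d × ℝ) (o : Option (Fin d)) (t : ℝ) :
    distSq d P (p + t • basisDir d o) = distSq d P p + 2 * coordH d o (p - P) * t + t ^ 2 := by
  have h : ∀ o', coordH d o' (p + t • basisDir d o - P) ^ 2 =
      coordH d o' (p - P) ^ 2 + if o' = o then 2 * coordH d o (p - P) * t + t ^ 2 else 0 := by
    intro o'
    rw [show p + t • basisDir d o - P = (p - P) + t • basisDir d o by abel, map_add, map_smul,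
      coordH_basisDir]
    split_ifs with h
    · subst h; simp; ring
    · simp
  rw [distSq_eq_sum, distSq_eq_sum, Finset.sum_congr rfl fun o' _ => h o',
    Finset.sum_add_distrib]
  simp; ring

theorem contDiff_distSq (P : Esp d × ℝ) : ContDiff ℝ 2 (distSq d P) := by
  unfold distSq
  exact ((contDiff_fst.sub contDiff_const).norm_sq ℝ).add
    ((contDiff_snd.sub contDiff_const).pow 2)

theorem lapH_eq_sum (u : Esp d × ℝ → ℝ) (p : Esp d × ℝ) :
    lapH d u p = ∑ o, deriv (deriv fun t : ℝ => u (p + t • basisDir d o)) 0 := by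
  have h1 : ∀ i (t : ℝ), p + t • basisDir d (some i) =
      (p.1 + t • EuclideanSpace.single i (1 : ℝ), p.2) := fun i t => by
    ext <;> simp [basisDir]
  have h2 : ∀ t : ℝ, p + t • basisDir d none = (p.1, p.2 + t) := fun t => by
    ext <;> simp [basisDir]
  simp only [Fintype.sum_option, h1, h2, lapH]
  ring

theorem contDiffAt_line {u : Esp d × ℝ → ℝ} {p : Esp d × ℝ} (hu : ContDiffAt ℝ 2 u p)
    (v : Esp d × ℝ) : ContDiffAt ℝ 2 (fun t : ℝ => u (p + t • v)) 0 := by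
  have h : ContDiffAt ℝ 2 (fun t : ℝ => p + t • v) 0 := by fun_prop
  exact ContDiffAt.comp (0 : ℝ) (by simpa using hu) h

theorem deriv_deriv_eq_iteratedDeriv (g : ℝ → ℝ) (x : ℝ) :
    deriv (deriv g) x = iteratedDeriv 2 g x := by
  simp [iteratedDeriv_succ]

theorem lapH_add {u v : Esp d × ℝ → ℝ} {p : Esp d × ℝ} (hu : ContDiffAt ℝ 2 u p)
    (hv : ContDiffAt ℝ 2 v p) : lapH d (fun q => u q + v q) p = lapH d u p + lapH d v p := by
  simp only [lapH_eq_sum, ← Finset.sum_add_distrib, deriv_deriv_eq_iteratedDeriv]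
  exact Finset.sum_congr rfl fun o _ =>
    iteratedDeriv_fun_add (contDiffAt_line hu _) (contDiffAt_line hv _)

theorem lapH_const_mul (c : ℝ) (u : Esp d × ℝ → ℝ) (p : Esp d × ℝ) :
    lapH d (fun q => c * u q) p = c * lapH d u p := by
  simp only [lapH_eq_sum, Finset.mul_sum, deriv_deriv_eq_iteratedDeriv]
  exact Finset.sum_congr rfl fun o _ => iteratedDeriv_const_mul_field c _

theorem lapH_sub {u v : Esp d × ℝ → ℝ} {p : Esp d × ℝ} (hu : ContDiffAt ℝ 2 u p)
    (hv : ContDiffAt ℝ 2 v p) : lapH d (fun q => u q - v q) p = lapH d u p - lapH d v p := by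
  simp only [lapH_eq_sum, ← Finset.sum_sub_distrib, deriv_deriv_eq_iteratedDeriv]
  exact Finset.sum_congr rfl fun o _ =>
    iteratedDeriv_fun_sub (contDiffAt_line hu _) (contDiffAt_line hv _)

theorem deriv_deriv_quadratic (A B C : ℝ) :
    deriv (deriv fun t : ℝ => A + B * t + C * t ^ 2) 0 = 2 * C := by
  have h : deriv (fun t : ℝ => A + B * t + C * t ^ 2) = fun t => B + 2 * C * t := by
    funext t
    have := (((hasDerivAt_id t).const_mul B).const_add A).add (((hasDerivAt_id t).pow 2).const_mul C)
    refine (HasDerivAt.congr_deriv (this.congr_of_eventuallyEq ?_) ?_).deriv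
    · exact Filter.Eventually.of_forall fun s => by simp
    · simp; ring
  rw [h]
  simp

theorem deriv_deriv_exp_quadratic (α A B : ℝ) :
    deriv (deriv fun t : ℝ => Real.exp (-α * (A + B * t + t ^ 2))) 0 =
      ((α * B) ^ 2 - 2 * α) * Real.exp (-α * A) := by
  have h0 : ∀ t : ℝ, HasDerivAt (fun t : ℝ => -α * (A + B * t + t ^ 2)) (-α * (B + 2 * t)) t := by
    intro t
    have := ((((hasDerivAt_id t).const_mul B).const_add A).add ((hasDerivAt_id t).pow 2)).const_mul
      (-α)
    refine HasDerivAt.congr_deriv (this.congr_of_eventuallyEq ?_) ?_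
    · exact Filter.Eventually.of_forall fun s => by simp
    · simp
  have h : deriv (fun t : ℝ => Real.exp (-α * (A + B * t + t ^ 2))) =
      fun t => Real.exp (-α * (A + B * t + t ^ 2)) * (-α * (B + 2 * t)) :=
    funext fun t => (h0 t).exp.deriv
  rw [h]
  have h1 : HasDerivAt (fun t : ℝ => -α * (B + 2 * t)) (-α * 2) 0 := by
    simpa using (((hasDerivAt_id (0 : ℝ)).const_mul 2).const_add B).const_mul (-α)
  refine ((h0 0).exp.mul h1).deriv.trans ?_
  simp; ring

theorem lapH_distSq (P p : Esp d × ℝ) : lapH d (distSq d P) p = 2 * (d + 1) := by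
  simp only [lapH_eq_sum, distSq_add_smul]
  have h : ∀ o : Option (Fin d), deriv (deriv fun t : ℝ =>
      distSq d P p + 2 * coordH d o (p - P) * t + t ^ 2) 0 = 2 := fun o => by
    simpa using deriv_deriv_quadratic (distSq d P p) (2 * coordH d o (p - P)) 1
  rw [Finset.sum_congr rfl fun o _ => h o]
  simp; ring

theorem lapH_exp_distSq (α : ℝ) (P p : Esp d × ℝ) :
    lapH d (fun q => Real.exp (-α * distSq d P q)) p =
      (4 * α ^ 2 * distSq d P p - 2 * α * (d + 1)) * Real.exp (-α * distSq d P p) := by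
  simp only [lapH_eq_sum, distSq_add_smul, deriv_deriv_exp_quadratic]
  rw [← Finset.sum_mul, Finset.sum_sub_distrib]
  have h : ∑ o : Option (Fin d), (α * (2 * coordH d o (p - P))) ^ 2 =
      4 * α ^ 2 * distSq d P p := by
    rw [distSq_eq_sum, Finset.mul_sum]
    exact Finset.sum_congr rfl fun o _ => by ring
  rw [h]
  congr 2
  simp; ring

theorem lapH_const (c : ℝ) (p : Esp d × ℝ) : lapH d (fun _ => c) p = 0 := by
  simp [lapH_eq_sum]

theorem lapH_clm (ℓ : (Esp d × ℝ) →L[ℝ] ℝ) (p : Esp d × ℝ) : lapH d ℓ p = 0 := by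
  simp only [lapH_eq_sum, map_add, map_smul]
  refine Finset.sum_eq_zero fun o _ => ?_
  simp

theorem lapH_coordH_sq (o : Option (Fin d)) (P p : Esp d × ℝ) :
    lapH d (fun q => coordH d o (q - P) ^ 2) p = 2 := by
  have h : ∀ o', deriv (deriv fun t : ℝ => coordH d o (p + t • basisDir d o' - P) ^ 2) 0 =
      if o' = o then 2 else 0 := by
    intro o'
    have h' : (fun t : ℝ => coordH d o (p + t • basisDir d o' - P) ^ 2) = fun t =>
        coordH d o (p - P) ^ 2 + (2 * coordH d o (p - P) * (if o = o' then 1 else 0)) * t +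
        (if o = o' then 1 else 0) * t ^ 2 := by
      funext t
      rw [show p + t • basisDir d o' - P = (p - P) + t • basisDir d o' by abel, map_add, map_smul,
        coordH_basisDir]
      split_ifs <;> simp; ring
    rw [h', deriv_deriv_quadratic]
    by_cases ho : o = o'
    · simp [ho]
    · simp [ho, Ne.symm ho]
  rw [lapH_eq_sum, Finset.sum_congr rfl fun o' _ => h o']
  simp

theorem lapH_comp_add (u : Esp d × ℝ → ℝ) (a p : Esp d × ℝ) :
    lapH d (fun q => u (q + a)) p = lapH d u (p + a) := by
  simp only [lapH_eq_sum, add_right_comm]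

/-- The reflection of `ℝ^d × ℝ` across the coordinate hyperplane through `P` orthogonal to the
coordinate direction `o`. -/
noncomputable def reflH (d : ℕ) (o : Option (Fin d)) (P p : Esp d × ℝ) : Esp d × ℝ :=
  p - (2 * coordH d o (p - P)) • basisDir d o

theorem lapH_comp_reflH (u : Esp d × ℝ → ℝ) (o : Option (Fin d)) (P p : Esp d × ℝ) :
    lapH d (fun q => u (reflH d o P q)) p = lapH d u (reflH d o P p) := by
  simp only [lapH_eq_sum]
  refine Finset.sum_congr rfl fun o' _ => ?_
  by_cases ho : o = o'
  · subst ho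
    have h : (fun t : ℝ => u (reflH d o P (p + t • basisDir d o))) =
        fun t => (fun s => u (reflH d o P p + s • basisDir d o)) (-t) := by
      funext t
      simp only [reflH]
      congr 1
      rw [show p + t • basisDir d o - P = (p - P) + t • basisDir d o by abel, map_add, map_smul,
        coordH_basisDir]
      simp only [if_true, smul_eq_mul, mul_one]
      module
    rw [h, deriv_deriv_eq_iteratedDeriv,
      iteratedDeriv_comp_neg 2 (fun s => u (reflH d o P p + s • basisDir d o)),
      deriv_deriv_eq_iteratedDeriv]
    simp
  · congr 2
    funext t
    simp only [reflH]
    congr 1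
    rw [show p + t • basisDir d o' - P = (p - P) + t • basisDir d o' by abel, map_add, map_smul,
        coordH_basisDir]
    simp only [ho, if_false, smul_eq_mul, mul_zero, add_zero]
    module

theorem distSq_reflH (o : Option (Fin d)) (P p : Esp d × ℝ) :
    distSq d P (reflH d o P p) = distSq d P p := by
  rw [reflH, sub_eq_add_neg, ← neg_smul, distSq_add_smul]
  ring

theorem contDiff_reflH (o : Option (Fin d)) (P : Esp d × ℝ) : ContDiff ℝ 2 (reflH d o P) := by
  unfold reflH
  fun_prop

theorem deriv_deriv_nonneg_of_isLocalMin {g : ℝ → ℝ} (hg : ContDiffAt ℝ 2 g 0)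
    (h : IsLocalMin g 0) : 0 ≤ deriv (deriv g) 0 := by
  by_contra! hneg
  have hmax := isLocalMax_of_deriv_deriv_neg hneg h.deriv_eq_zero hg.continuousAt
  have hconst : g =ᶠ[nhds 0] fun _ => g 0 := by
    filter_upwards [h, hmax] with t h1 h2 using le_antisymm h2 h1
  rw [hconst.deriv.deriv_eq] at hneg
  simp at hneg

/-- Weak minimum principle: a strictly superharmonic function attains its minimum over a compact
set outside the open set where it is superharmonic. -/
theorem exists_isMinOn_notMem_of_lapH_neg {K U : Set (Esp d × ℝ)} (hK : IsCompact K)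
    (hU : IsOpen U) (hUK : U ⊆ K) {G : Esp d × ℝ → ℝ} (hG : ContinuousOn G K)
    (hC : ∀ p ∈ U, ContDiffAt ℝ 2 G p) (hlap : ∀ p ∈ U, lapH d G p < 0) (hne : K.Nonempty) :
    ∃ q ∈ K, q ∉ U ∧ IsMinOn G K q := by
  obtain ⟨q, hq, hmin⟩ := hK.exists_isMinOn hne hG
  refine ⟨q, hq, fun hqU => ?_, hmin⟩
  refine (hlap q hqU).not_ge ?_
  rw [lapH_eq_sum]
  refine Finset.sum_nonneg fun o _ => ?_
  refine deriv_deriv_nonneg_of_isLocalMin (contDiffAt_line (hC q hqU) _) ?_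
  have hc : Filter.Tendsto (fun t : ℝ => q + t • basisDir d o) (nhds 0) (nhds q) := by
    have : Continuous fun t : ℝ => q + t • basisDir d o := by fun_prop
    simpa using this.tendsto 0
  have hmem := hc.eventually (hU.mem_nhds hqU)
  filter_upwards [hmem] with t ht
  simpa using hmin (hUK ht)

theorem isCompact_distSq_le (P : Esp d × ℝ) (R : ℝ) : IsCompact {p | distSq d P p ≤ R ^ 2} := by
  refine (isCompact_closedBall P |R|).of_isClosed_subset
    (isClosed_le (contDiff_distSq P).continuous continuous_const) fun p hp => ?_
  have hp' : ‖p.1 - P.1‖ ^ 2 + (p.2 - P.2) ^ 2 ≤ R ^ 2 := hp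
  rw [mem_closedBall_iff_norm, Prod.norm_def]
  refine max_le ((le_abs_self _).trans (sq_le_sq.1 ?_)) (sq_le_sq.1 ?_)
  · simp only [Prod.fst_sub]; nlinarith [sq_nonneg (p.2 - P.2)]
  · simp only [Prod.snd_sub]; nlinarith [sq_nonneg ‖p.1 - P.1‖]

theorem fderiv_basisDir_le {S : Set (Esp d × ℝ)} (hS : IsOpen S) {w : Esp d × ℝ → ℝ}
    (hw : HarmonicOnH d w S) {P : Esp d × ℝ} {R M : ℝ} (hR : 0 < R) (hM : 0 < M)
    (hball : ∀ p, distSq d P p ≤ R ^ 2 → p ∈ S) (hb : ∀ p, distSq d P p ≤ R ^ 2 → |w p| ≤ M)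
    (o : Option (Fin d)) : fderiv ℝ w P (basisDir d o) ≤ M / R * (d + 2) := by
  set c : ℝ := 2 * M / R ^ 2 with hc
  have hcpos : 0 < c := by positivity
  have hcR : c * R ^ 2 = 2 * M := by rw [hc]; field_simp
  set s : Esp d × ℝ → ℝ := fun p => coordH d o (p - P) with hs
  have hsC : ContDiff ℝ 2 s := by fun_prop
  set β : Esp d × ℝ → ℝ := fun p => c * (distSq d P p + (d + 2) * (R * s p - s p ^ 2)) with hβ
  have hβC : ContDiff ℝ 2 β :=
    contDiff_const.mul ((contDiff_distSq P).add (contDiff_const.mul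
      ((contDiff_const.mul hsC).sub (hsC.pow 2))))
  have hslap : ∀ p, lapH d s p = 0 := fun p => by
    have := lapH_sub (p := p) (u := coordH d o) (v := fun _ => coordH d o P)
      (coordH d o).contDiff.contDiffAt contDiff_const.contDiffAt
    rw [lapH_clm, lapH_const] at this
    simpa [hs] using this
  have hβlap : ∀ p, lapH d β p = -2 * c := fun p => by
    rw [hβ, lapH_const_mul, lapH_add (contDiff_distSq P).contDiffAt
      (contDiff_const.mul ((contDiff_const.mul hsC).sub (hsC.pow 2))).contDiffAt, lapH_const_mul,
      lapH_sub (contDiff_const.mul hsC).contDiffAt (hsC.pow 2).contDiffAt, lapH_const_mul,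
      hslap, lapH_coordH_sq, lapH_distSq]
    ring
  set G : Esp d × ℝ → ℝ := fun p => β p - (w p - w (reflH d o P p)) with hG
  set K : Set (Esp d × ℝ) := {p | distSq d P p ≤ R ^ 2 ∧ 0 ≤ s p} with hKdef
  set U : Set (Esp d × ℝ) := {p | distSq d P p < R ^ 2 ∧ 0 < s p} with hUdef
  have hwC : ∀ p, distSq d P p ≤ R ^ 2 → ContDiffAt ℝ 2 w p := fun p hp =>
    hw.1.contDiffAt (hS.mem_nhds (hball p hp))
  have hwrC : ∀ p, distSq d P p ≤ R ^ 2 → ContDiffAt ℝ 2 (fun q => w (reflH d o P q)) p :=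
    fun p hp => ContDiffAt.comp p (hwC _ (by rwa [distSq_reflH])) (contDiff_reflH o P).contDiffAt
  have hGC : ∀ p, distSq d P p ≤ R ^ 2 → ContDiffAt ℝ 2 G p := fun p hp =>
    hβC.contDiffAt.sub ((hwC p hp).sub (hwrC p hp))
  have hGK : ∀ p ∈ K, 0 ≤ G p := by
    intro p hp
    have hK : IsCompact K := (isCompact_distSq_le P R).inter_right
      (isClosed_le continuous_const hsC.continuous)
    have hU : IsOpen U := (isOpen_lt (contDiff_distSq P).continuous continuous_const).inter
      (isOpen_lt continuous_const hsC.continuous)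
    obtain ⟨q, hqK, hqU, hmin⟩ := exists_isMinOn_notMem_of_lapH_neg hK hU
      (fun q hq => ⟨hq.1.le, hq.2.le⟩)
      (fun q hq => (hGC q hq.1).continuousAt.continuousWithinAt)
      (fun q hq => hGC q hq.1.le) (fun q hq => by
        rw [hG, lapH_sub hβC.contDiffAt ((hwC q hq.1.le).sub (hwrC q hq.1.le)),
          lapH_sub (hwC q hq.1.le) (hwrC q hq.1.le), lapH_comp_reflH, hβlap,
          hw.2 _ (hball q hq.1.le), hw.2 _ (hball _ (by rw [distSq_reflH]; exact hq.1.le))]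
        linarith) ⟨p, hp⟩
    refine le_trans ?_ (hmin hp)
    by_cases h : distSq d P q < R ^ 2
    · have hsq : s q = 0 := le_antisymm (not_lt.1 fun h' => hqU ⟨h, h'⟩) hqK.2
      have hrefl : reflH d o P q = q := by
        simp only [hs] at hsq
        simp [reflH, hsq]
      simp only [hG, hβ, hrefl, hsq]
      have := mul_nonneg hcpos.le (distSq_nonneg P q)
      linarith
    · have hqR : distSq d P q = R ^ 2 := le_antisymm hqK.1 (not_lt.1 h)
      have h1 := abs_le.1 (hb q hqK.1)
      have h2 := abs_le.1 (hb (reflH d o P q) (by rw [distSq_reflH]; exact hqK.1))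
      have hsR : s q ≤ R := by
        refine (le_abs_self _).trans (abs_le_of_sq_le_sq ?_ hR.le)
        rw [← hqR, distSq_eq_sum]
        exact Finset.single_le_sum (f := fun o => coordH d o (q - P) ^ 2)
          (fun _ _ => sq_nonneg _) (Finset.mem_univ o)
      have h3 : 0 ≤ c * ((d + 2) * (R * s q - s q ^ 2)) := by
        have : 0 ≤ R * s q - s q ^ 2 := by nlinarith [hqK.2]
        positivity
      simp only [hG, hβ, hqR]
      nlinarith
  have hline : ∀ t : ℝ, s (P + t • basisDir d o) = t := fun t => by
    simp [hs, coordH_basisDir]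
  have hlined : ∀ t : ℝ, distSq d P (P + t • basisDir d o) = t ^ 2 := fun t => by
    rw [distSq_add_smul]; simp [distSq]
  have hineq : ∀ t : ℝ, 0 < t → t < R →
      w (P + t • basisDir d o) - w (P + (-t) • basisDir d o) ≤
        c * (t ^ 2 + (d + 2) * (R * t - t ^ 2)) := by
    intro t ht htR
    have := hGK (P + t • basisDir d o) ⟨by rw [hlined]; gcongr, by rw [hline]; exact ht.le⟩
    have hrefl : reflH d o P (P + t • basisDir d o) = P + (-t) • basisDir d o := by
      have h := hline t
      simp only [hs] at h
      rw [reflH, h]; module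
    simp only [hG, hβ, hlined, hline, hrefl] at this
    linarith
  have hdiff : HasFDerivAt w (fderiv ℝ w P) P :=
    ((hwC P (by simp [distSq]; positivity)).differentiableAt (by norm_num)).hasFDerivAt
  have hd1 : ∀ σ : ℝ, HasDerivAt (fun t : ℝ => w (P + (σ * t) • basisDir d o))
      (σ * fderiv ℝ w P (basisDir d o)) 0 := by
    intro σ
    have h1 : HasDerivAt (fun t : ℝ => P + (σ * t) • basisDir d o) (σ • basisDir d o) 0 := by
      have := (((hasDerivAt_id (0 : ℝ)).const_mul σ).smul_const (basisDir d o)).const_add P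
      simpa using this
    have h2 := HasFDerivAt.comp_hasDerivAt (0 : ℝ) (f := fun t : ℝ => P + (σ * t) • basisDir d o)
      (by simpa using hdiff) h1
    rw [map_smul, smul_eq_mul] at h2
    exact h2
  have hd2 : HasDerivAt (fun t : ℝ => w (P + t • basisDir d o) - w (P + (-t) • basisDir d o))
      (2 * fderiv ℝ w P (basisDir d o)) 0 := by
    have := (hd1 1).sub (hd1 (-1))
    refine HasDerivAt.congr_deriv (this.congr_of_eventuallyEq ?_) ?_
    · exact Filter.Eventually.of_forall fun t => by simp
    · ring
  have hIoi : nhdsWithin (0 : ℝ) (Ioi 0) ≤ nhdsWithin 0 {0}ᶜ :=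
    nhdsWithin_mono 0 fun t ht => (mem_Ioi.1 ht).ne'
  have hlim1 := (hasDerivAt_iff_tendsto_slope_zero.1 hd2).mono_left hIoi
  have hlim2 : Filter.Tendsto (fun t : ℝ => c * (t + (d + 2) * (R - t)))
      (nhdsWithin 0 (Ioi 0)) (nhds (c * (0 + (d + 2) * (R - 0)))) := by
    have : Continuous fun t : ℝ => c * (t + (d + 2) * (R - t)) := by fun_prop
    exact (this.tendsto 0).mono_left nhdsWithin_le_nhds
  have hle := le_of_tendsto_of_tendsto hlim1 hlim2 (by
    filter_upwards [Ioo_mem_nhdsGT hR] with t ht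
    have := hineq t ht.1 ht.2
    simp only [zero_add, zero_smul, add_zero, neg_zero, sub_self, sub_zero, smul_eq_mul]
    rw [inv_mul_le_iff₀ ht.1]
    linarith)
  have : c * (0 + (d + 2) * (R - 0)) = 2 * (M / R * (d + 2)) := by
    rw [hc]; field_simp; ring
  linarith

theorem lapH_neg (u : Esp d × ℝ → ℝ) (p : Esp d × ℝ) :
    lapH d (fun q => -u q) p = -lapH d u p := by
  simpa using lapH_const_mul (-1) u p

/-- Interior gradient estimate for bounded harmonic functions, in a coordinate direction. -/
theorem abs_fderiv_basisDir_le {S : Set (Esp d × ℝ)} (hS : IsOpen S) {w : Esp d × ℝ → ℝ}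
    (hw : HarmonicOnH d w S) {P : Esp d × ℝ} {R M : ℝ} (hR : 0 < R) (hM : 0 < M)
    (hball : ∀ p, distSq d P p ≤ R ^ 2 → p ∈ S) (hb : ∀ p, distSq d P p ≤ R ^ 2 → |w p| ≤ M)
    (o : Option (Fin d)) : |fderiv ℝ w P (basisDir d o)| ≤ M / R * (d + 2) := by
  refine abs_le.2 ⟨?_, fderiv_basisDir_le hS hw hR hM hball hb o⟩
  have h := fderiv_basisDir_le (w := fun q => -w q) hS
    ⟨hw.1.neg, fun p hp => by rw [lapH_neg, hw.2 p hp, neg_zero]⟩ hR hM hball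
    (fun p hp => by simpa using hb p hp) o
  rw [fderiv_fun_neg] at h
  simp only [neg_apply] at h
  linarith

theorem norm_fderiv_le {S : Set (Esp d × ℝ)} (hS : IsOpen S) {w : Esp d × ℝ → ℝ}
    (hw : HarmonicOnH d w S) {P : Esp d × ℝ} {R M : ℝ} (hR : 0 < R) (hM : 0 < M)
    (hball : ∀ p, distSq d P p ≤ R ^ 2 → p ∈ S) (hb : ∀ p, distSq d P p ≤ R ^ 2 → |w p| ≤ M) :
    ‖fderiv ℝ w P‖ ≤ (d + 1) * (M / R * (d + 2)) := by
  refine ContinuousLinearMap.opNorm_le_bound _ (by positivity) fun v => ?_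
  conv_lhs => rw [eq_sum_coordH_smul v]
  rw [map_sum]
  refine (norm_sum_le _ _).trans ?_
  have : ∀ o ∈ Finset.univ, ‖fderiv ℝ w P (coordH d o v • basisDir d o)‖ ≤
      ‖v‖ * (M / R * (d + 2)) := by
    intro o _
    rw [map_smul, norm_smul]
    exact mul_le_mul (abs_coordH_le o v) (abs_fderiv_basisDir_le hS hw hR hM hball hb o)
      (norm_nonneg _) (norm_nonneg _)
  refine (Finset.sum_le_sum this).trans (le_of_eq ?_)
  simp; ring

theorem lapH_exp_distSq_pos {r : ℝ} (hr : 0 < r) {P p : Esp d × ℝ} (hp : r ^ 2 < distSq d P p) :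
    0 < lapH d (fun q => Real.exp (-((d + 1) / r ^ 2) * distSq d P q)) p := by
  rw [lapH_exp_distSq]
  refine mul_pos ?_ (Real.exp_pos _)
  have hα : (0 : ℝ) < (d + 1) / r ^ 2 := by positivity
  have h1 : (d + 1) / r ^ 2 * r ^ 2 = (d + 1 : ℝ) := by field_simp
  have h2 : (d + 1 : ℝ) < (d + 1) / r ^ 2 * distSq d P p := by
    calc (d + 1 : ℝ) = (d + 1) / r ^ 2 * r ^ 2 := h1.symm
      _ < _ := by gcongr
  generalize (d + 1 : ℝ) / r ^ 2 = α at *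
  have h3 : (0 : ℝ) < d + 1 := by positivity
  nlinarith

/-- Quantitative propagation of positivity of a harmonic function from a ball to a larger one. -/
theorem le_of_harmonicOnH_of_le_on_ball {S : Set (Esp d × ℝ)} (hS : IsOpen S)
    {V : Esp d × ℝ → ℝ} (hV : HarmonicOnH d V S) {P : Esp d × ℝ} {r R R' c m : ℝ} (hr : 0 < r)
    (hc : 0 < c) (hm : 0 ≤ m) (hR' : 0 ≤ R') (hRR : R' ≤ R)
    (hball : ∀ p, distSq d P p ≤ R ^ 2 → p ∈ S)
    (hlow : ∀ p, distSq d P p ≤ R ^ 2 → -m ≤ V p) (hcV : ∀ p, distSq d P p ≤ r ^ 2 → c ≤ V p)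
    {p : Esp d × ℝ} (hp : distSq d P p ≤ R' ^ 2) :
    c * (Real.exp (-((d + 1) / r ^ 2) * R' ^ 2) - Real.exp (-((d + 1) / r ^ 2) * R ^ 2)) - m ≤
      V p := by
  have hlap := fun q : Esp d × ℝ => lapH_exp_distSq_pos (P := P) (p := q) hr
  have hα : (0 : ℝ) < (d + 1) / r ^ 2 := by positivity
  generalize (d + 1 : ℝ) / r ^ 2 = α at *
  have hpR : distSq d P p ≤ R ^ 2 := hp.trans (by gcongr)
  have he1 : ∀ x : ℝ, 0 ≤ x → Real.exp (-α * x) ≤ 1 := fun x hx => by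
    rw [Real.exp_le_one_iff]; nlinarith
  have hmono : ∀ x y : ℝ, x ≤ y → Real.exp (-α * y) ≤ Real.exp (-α * x) := fun x y hxy =>
    Real.exp_le_exp.2 (by nlinarith)
  by_cases hpr : distSq d P p ≤ r ^ 2
  · have h1 := hcV p hpr
    have h2 := he1 (R' ^ 2) (by positivity)
    have h3 := Real.exp_pos (-α * R ^ 2)
    nlinarith
  set b : Esp d × ℝ → ℝ := fun q => Real.exp (-α * distSq d P q) with hb
  have hbC : ContDiff ℝ 2 b := (contDiff_const.mul (contDiff_distSq P)).exp
  set K : Set (Esp d × ℝ) := {q | distSq d P q ≤ R ^ 2 ∧ r ^ 2 ≤ distSq d P q}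
  set U : Set (Esp d × ℝ) := {q | distSq d P q < R ^ 2 ∧ r ^ 2 < distSq d P q}
  have hdc := (contDiff_distSq P).continuous
  have hVC : ∀ q, distSq d P q ≤ R ^ 2 → ContDiffAt ℝ 2 V q := fun q hq =>
    hV.1.contDiffAt (hS.mem_nhds (hball q hq))
  have hcb : ContDiff ℝ 2 fun q => (c + m) * b q := contDiff_const.mul hbC
  obtain ⟨q, hqK, hqU, hmin⟩ := exists_isMinOn_notMem_of_lapH_neg (K := K) (U := U)
    (G := fun q => V q - (c + m) * b q)
    ((isCompact_distSq_le P R).inter_right (isClosed_le continuous_const hdc))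
    ((isOpen_lt hdc continuous_const).inter (isOpen_lt continuous_const hdc))
    (fun q hq => ⟨hq.1.le, hq.2.le⟩)
    (fun q hq => ((hVC q hq.1).sub hcb.contDiffAt).continuousAt.continuousWithinAt)
    (fun q hq => (hVC q hq.1.le).sub hcb.contDiffAt)
    (fun q hq => by
      rw [lapH_sub (hVC q hq.1.le) hcb.contDiffAt, lapH_const_mul, hV.2 q (hball q hq.1.le)]
      have := mul_pos (by linarith : 0 < c + m) (hlap q hq.2)
      linarith) ⟨p, hpR, (not_le.1 hpr).le⟩
  have hq0 : -m - (c + m) * Real.exp (-α * R ^ 2) ≤ V q - (c + m) * b q := by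
    by_cases h : distSq d P q < R ^ 2
    · have h1 := hcV q (not_lt.1 fun h' => hqU ⟨h, h'⟩)
      have h2 := he1 _ (distSq_nonneg P q)
      have h3 := Real.exp_pos (-α * R ^ 2)
      simp only [hb]
      nlinarith
    · have h1 := hlow q hqK.1
      have h2 := hmono _ _ (not_lt.1 h)
      simp only [hb]
      nlinarith
  have h1 : V q - (c + m) * b q ≤ V p - (c + m) * b p := hmin ⟨hpR, (not_le.1 hpr).le⟩
  have h2 : Real.exp (-α * R' ^ 2) ≤ b p := hmono _ _ hp
  have h3 : Real.exp (-α * R ^ 2) ≤ Real.exp (-α * R' ^ 2) := hmono _ _ (by gcongr)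
  nlinarith

theorem norm_fst_sub_le_of_distSq_le {P p : Esp d × ℝ} {R : ℝ} (hR : 0 ≤ R)
    (h : distSq d P p ≤ R ^ 2) : ‖p.1 - P.1‖ ≤ R ∧ |p.2 - P.2| ≤ R := by
  unfold distSq at h
  exact ⟨(le_abs_self _).trans (abs_le_of_sq_le_sq (by nlinarith [sq_nonneg (p.2 - P.2)]) hR),
    abs_le_of_sq_le_sq (by nlinarith [sq_nonneg ‖p.1 - P.1‖]) hR⟩

theorem abs_sub_sub_fderiv_le {φ : Esp d → ℝ} {δ : ℝ} (hδ : 0 ≤ δ)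
    (hd : ∀ x : Esp d, ‖x‖ < 1 → DifferentiableAt ℝ φ x)
    (hl : ∀ x y : Esp d, ‖x‖ < 1 → ‖y‖ < 1 → ‖fderiv ℝ φ x - fderiv ℝ φ y‖ ≤ δ * ‖x - y‖)
    {x z : Esp d} (hx : ‖x‖ < 1) (hz : ‖z‖ < 1) :
    |φ x - φ z - fderiv ℝ φ z (x - z)| ≤ δ * ‖x - z‖ ^ 2 := by
  have hseg : ∀ y ∈ segment ℝ z x, ‖y‖ < 1 := fun y hy => by
    have := (convex_ball (0 : Esp d) 1).segment_subset (by simpa using hz) (by simpa using hx) hy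
    simpa using this
  have h := (convex_segment z x).norm_image_sub_le_of_norm_fderiv_le' (𝕜 := ℝ) (f := φ)
    (φ := fderiv ℝ φ z) (C := δ * ‖x - z‖) (fun y hy => hd y (hseg y hy)) (fun y hy =>
      (hl y z (hseg y hy) hz).trans (by
        gcongr
        obtain ⟨a, b, ha, hb, hab, rfl⟩ := hy
        have : a • z + b • x - z = b • (x - z) := by
          rw [← eq_sub_iff_add_eq] at hab; subst hab; module
        rw [this, norm_smul, Real.norm_of_nonneg hb]
        nlinarith [norm_nonneg (x - z)])) (left_mem_segment ℝ z x) (right_mem_segment ℝ z x)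
  rw [Real.norm_eq_abs] at h
  linarith

theorem hasDerivAt_pdy {u : Esp d × ℝ → ℝ} {p : Esp d × ℝ} (hu : DifferentiableAt ℝ u p) :
    HasDerivAt (fun t : ℝ => u (p.1, p.2 + t)) (pdy d u p) 0 := by
  refine DifferentiableAt.hasDerivAt ?_
  have h : DifferentiableAt ℝ (fun t : ℝ => ((p.1, p.2 + t) : Esp d × ℝ)) 0 := by fun_prop
  exact DifferentiableAt.comp (0 : ℝ) (by simpa using hu) h

theorem hasDerivAt_vertical {u : Esp d × ℝ → ℝ} {x : Esp d} {y : ℝ}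
    (hu : DifferentiableAt ℝ u (x, y)) :
    HasDerivAt (fun t : ℝ => u (x, t)) (pdy d u (x, y)) y := by
  have h := hasDerivAt_pdy hu
  rw [← sub_self y] at h
  simpa using h.comp_sub_const y y

theorem vertical_sub_le {u : Esp d × ℝ → ℝ} {x : Esp d} {a b C : ℝ} (hab : a ≤ b)
    (hc : ContinuousOn (fun y => u (x, y)) (Icc a b))
    (hu : ∀ y ∈ Ioo a b, DifferentiableAt ℝ u (x, y))
    (hC : ∀ y ∈ Ioo a b, pdy d u (x, y) ≤ C) : u (x, b) - u (x, a) ≤ C * (b - a) := by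
  refine (convex_Icc a b).image_sub_le_mul_sub_of_deriv_le hc ?_ ?_ a (left_mem_Icc.2 hab) b
    (right_mem_Icc.2 hab) hab
  · rw [interior_Icc]
    exact fun y hy => (hasDerivAt_vertical (hu y hy)).differentiableAt.differentiableWithinAt
  · rw [interior_Icc]
    exact fun y hy => (hasDerivAt_vertical (hu y hy)).deriv.le.trans (hC y hy)

theorem le_vertical_sub {u : Esp d × ℝ → ℝ} {x : Esp d} {a b C : ℝ} (hab : a ≤ b)
    (hc : ContinuousOn (fun y => u (x, y)) (Icc a b))
    (hu : ∀ y ∈ Ioo a b, DifferentiableAt ℝ u (x, y))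
    (hC : ∀ y ∈ Ioo a b, C ≤ pdy d u (x, y)) : C * (b - a) ≤ u (x, b) - u (x, a) := by
  refine (convex_Icc a b).mul_sub_le_image_sub_of_le_deriv hc ?_ ?_ a (left_mem_Icc.2 hab) b
    (right_mem_Icc.2 hab) hab
  · rw [interior_Icc]
    exact fun y hy => (hasDerivAt_vertical (hu y hy)).differentiableAt.differentiableWithinAt
  · rw [interior_Icc]
    exact fun y hy => (hC y hy).trans (hasDerivAt_vertical (hu y hy)).deriv.ge

/-- The cylinder `B₁' × (0, h)`. -/
def openCyl (d : ℕ) (h : ℝ) : Set (Esp d × ℝ) := {p | ‖p.1‖ < 1 ∧ 0 < p.2 ∧ p.2 < h}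

theorem isOpen_openCyl (h : ℝ) : IsOpen (openCyl d h) :=
  (isOpen_lt continuous_fst.norm continuous_const).inter
    ((isOpen_lt continuous_const continuous_snd).inter (isOpen_lt continuous_snd continuous_const))

theorem mem_openCyl_of_distSq_le {P p : Esp d × ℝ} {R h : ℝ} (hR : 0 ≤ R)
    (hp : distSq d P p ≤ R ^ 2) (h1 : ‖P.1‖ + R < 1) (h2 : R < P.2) (h3 : P.2 + R < h) :
    p ∈ openCyl d h := by
  obtain ⟨h4, h5⟩ := norm_fst_sub_le_of_distSq_le hR hp
  have := norm_le_norm_add_norm_sub' p.1 P.1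
  obtain ⟨h6, h7⟩ := abs_le.1 h5
  exact ⟨by linarith, by linarith, by linarith⟩

/-- The vertical derivative of a harmonic function, when bounded, is Lipschitz in the interior. -/
theorem abs_pdy_sub_le {u : Esp d × ℝ → ℝ} (hu : HarmonicOnH d u (openCyl d 1)) {M : ℝ}
    (hM : 0 < M) (hb : ∀ p ∈ openCyl d 1, |pdy d u p| ≤ M) {x : Esp d} (hx : ‖x‖ ≤ 1 / 2)
    {p : Esp d × ℝ} (hp : ‖p - (x, 1 / 2)‖ ≤ 1 / 10) :
    |pdy d u p - pdy d u (x, 1 / 2)| ≤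
      (d + 1) * (M / (3 / 10) * (d + 2)) * ‖p - (x, 1 / 2)‖ := by
  have hdiff : ∀ q ∈ openCyl d 1, ContDiffAt ℝ 2 u q := fun q hq =>
    hu.1.contDiffAt ((isOpen_openCyl 1).mem_nhds hq)
  have hball : ∀ m ∈ Metric.closedBall ((x, 1 / 2) : Esp d × ℝ) (1 / 10), ∀ q,
      distSq d m q ≤ (3 / 10) ^ 2 → q ∈ openCyl d (19 / 20) := by
    intro m hm q hq
    rw [mem_closedBall_iff_norm, Prod.norm_def, max_le_iff] at hm
    have h1 := norm_le_norm_add_norm_sub' m.1 x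
    have h2 := abs_le.1 hm.2
    have h3 := hm.1
    simp only [Prod.fst_sub, Prod.snd_sub] at h2 h3
    exact mem_openCyl_of_distSq_le (by norm_num) hq (by linarith) (by linarith) (by linarith)
  have hpB : p ∈ Metric.closedBall ((x, 1 / 2) : Esp d × ℝ) (1 / 10) :=
    mem_closedBall_iff_norm.2 hp
  have hxB : (x, 1 / 2) ∈ Metric.closedBall ((x, 1 / 2) : Esp d × ℝ) (1 / 10) :=
    Metric.mem_closedBall_self (by norm_num)
  set w : ℝ → Esp d × ℝ → ℝ := fun h q => h⁻¹ * (u (q + (0, h)) - u q) with hw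
  have hshift : ∀ h ∈ Ioo (0 : ℝ) (1 / 20), ∀ q ∈ openCyl d (19 / 20),
      q ∈ openCyl d 1 ∧ q + (0, h) ∈ openCyl d 1 := by
    intro h hh q hq
    refine ⟨⟨hq.1, hq.2.1, by linarith [hq.2.2]⟩, ?_⟩
    simp only [openCyl, mem_ofPred_eq, Prod.fst_add, add_zero, Prod.snd_add]
    exact ⟨hq.1, by linarith [hq.2.1, hh.1], by linarith [hq.2.2, hh.2]⟩
  have hsC : ∀ h ∈ Ioo (0 : ℝ) (1 / 20), ∀ q ∈ openCyl d (19 / 20),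
      ContDiffAt ℝ 2 (fun q : Esp d × ℝ => u (q + (0, h))) q := by
    intro h hh q hq
    have h1 : ContDiffAt ℝ 2 (fun q : Esp d × ℝ => q + (0, h)) q := by fun_prop
    exact ContDiffAt.comp q (f := fun q : Esp d × ℝ => q + (0, h)) (g := u)
      (hdiff _ (hshift h hh q hq).2) h1
  have hwC : ∀ h ∈ Ioo (0 : ℝ) (1 / 20), ∀ q ∈ openCyl d (19 / 20), ContDiffAt ℝ 2 (w h) q := by
    intro h hh q hq
    obtain ⟨h1, h2⟩ := hshift h hh q hq
    exact contDiffAt_const.mul ((hsC h hh q hq).sub (hdiff q h1))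
  have hwH : ∀ h ∈ Ioo (0 : ℝ) (1 / 20), HarmonicOnH d (w h) (openCyl d (19 / 20)) := by
    intro h hh
    refine ⟨fun q hq => (hwC h hh q hq).contDiffWithinAt, fun q hq => ?_⟩
    obtain ⟨h1, h2⟩ := hshift h hh q hq
    rw [hw, lapH_const_mul, lapH_sub (hsC h hh q hq) (hdiff q h1),
      lapH_comp_add, hu.2 _ h1, hu.2 _ h2]
    ring
  have hwb : ∀ h ∈ Ioo (0 : ℝ) (1 / 20), ∀ q ∈ openCyl d (19 / 20), |w h q| ≤ M := by
    intro h hh q hq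
    have hin : ∀ y ∈ Icc q.2 (q.2 + h), (q.1, y) ∈ openCyl d 1 := fun y hy =>
      ⟨hq.1, hq.2.1.trans_le hy.1, by linarith [hy.2, hq.2.2, hh.2]⟩
    have hc : ContinuousOn (fun y => u (q.1, y)) (Icc q.2 (q.2 + h)) := fun y hy =>
      (hasDerivAt_vertical ((hdiff _ (hin y hy)).differentiableAt
        (by norm_num))).continuousAt.continuousWithinAt
    have hd : ∀ y ∈ Ioo q.2 (q.2 + h), DifferentiableAt ℝ u (q.1, y) := fun y hy =>
      (hdiff _ (hin y (Ioo_subset_Icc_self hy))).differentiableAt (by norm_num)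
    have h1 := vertical_sub_le (by linarith [hh.1]) hc hd fun y hy =>
      (abs_le.1 (hb _ (hin y (Ioo_subset_Icc_self hy)))).2
    have h2 := le_vertical_sub (by linarith [hh.1]) hc hd fun y hy =>
      (abs_le.1 (hb _ (hin y (Ioo_subset_Icc_self hy)))).1
    have h3 : u (q + (0, h)) - u q = u (q.1, q.2 + h) - u (q.1, q.2) := by
      congr 2; ext <;> simp
    simp only [hw, h3]
    rw [abs_mul, abs_of_pos (inv_pos.2 hh.1), inv_mul_le_iff₀ hh.1]
    exact abs_le.2 ⟨by linarith, by linarith⟩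
  have hlip : ∀ h ∈ Ioo (0 : ℝ) (1 / 20), |w h p - w h (x, 1 / 2)| ≤
      (d + 1) * (M / (3 / 10) * (d + 2)) * ‖p - (x, 1 / 2)‖ := by
    intro h hh
    refine (convex_closedBall _ _).norm_image_sub_le_of_norm_fderiv_le (𝕜 := ℝ)
      (fun m hm => (hwC h hh m ?_).differentiableAt (by norm_num)) (fun m hm => ?_) hxB hpB
    · exact hball m hm m (by simp [distSq]; norm_num)
    · exact norm_fderiv_le (isOpen_openCyl _) (hwH h hh) (by norm_num) hM (hball m hm)
        fun q hq => hwb h hh q (hball m hm q hq)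
  have hlim : ∀ m ∈ Metric.closedBall ((x, 1 / 2) : Esp d × ℝ) (1 / 10),
      Filter.Tendsto (fun h => w h m) (nhdsWithin 0 (Ioi 0)) (nhds (pdy d u m)) := by
    intro m hm
    have hmem : m ∈ openCyl d (19 / 20) := hball m hm m (by simp [distSq]; norm_num)
    have h1 := hasDerivAt_pdy ((hdiff m ⟨hmem.1, hmem.2.1, by linarith [hmem.2.2]⟩).differentiableAt
      (by norm_num))
    have hIoi : nhdsWithin (0 : ℝ) (Ioi 0) ≤ nhdsWithin 0 {0}ᶜ :=
      nhdsWithin_mono 0 fun t ht => (mem_Ioi.1 ht).ne'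
    refine ((hasDerivAt_iff_tendsto_slope_zero.1 h1).mono_left hIoi).congr fun h => ?_
    have h3 : m + (0, h) = (m.1, m.2 + h) := by ext <;> simp
    simp [hw, h3]
  refine le_of_tendsto ((hlim p hpB).sub (hlim _ hxB)).abs ?_
  filter_upwards [Ioo_mem_nhdsGT (show (0 : ℝ) < 1 / 20 by norm_num)] with h hh using hlip h hh

theorem vertical_sub_le_of_pdy_le {u : Esp d × ℝ → ℝ}
    (huc : ContinuousOn u {p : Esp d × ℝ | ‖p.1‖ < 1 ∧ 0 ≤ p.2 ∧ p.2 < 1})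
    (huh : HarmonicOnH d u (openCyl d 1)) {x : Esp d} {a b C : ℝ} (hx : ‖x‖ < 1) (ha : 0 ≤ a)
    (hab : a ≤ b) (hb : b < 1) (hC : ∀ y ∈ Ioo a b, pdy d u (x, y) ≤ C) :
    u (x, b) - u (x, a) ≤ C * (b - a) := by
  have hcont : ContinuousOn (fun y : ℝ => ((x, y) : Esp d × ℝ)) (Icc a b) :=
    (Continuous.prodMk_right x).continuousOn
  refine vertical_sub_le hab (huc.comp hcont fun y hy => ⟨hx, ha.trans hy.1, hy.2.trans_lt hb⟩)
    (fun y hy => ?_) hC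
  have hmem : (x, y) ∈ openCyl d 1 := ⟨hx, ha.trans_lt hy.1, hy.2.trans hb⟩
  exact (huh.1.contDiffAt ((isOpen_openCyl 1).mem_nhds hmem)).differentiableAt (by norm_num)

set_option maxHeartbeats 1000000 in
/-- The Hopf-type barrier step: if `u` stays well below `θ y` on a ball above the point `z`, then
`u` cannot lie above the obstacle at `z`. -/
theorem le_obstacle_of_le_on_ball {θ δ c α : ℝ} (hα : α = (d + 1) / (1 / 20) ^ 2) (hc : 0 < c)
    (hδ : 0 < δ) (hδ1 : δ ≤ 1 / 2)
    (hδ2 : 4 * δ ≤ c / 2 * (Real.exp (-α * (4 / 25)) - Real.exp (-α * (1 / 4))))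
    (hδ3 : 2 * δ ≤ c / 2 * (α * Real.exp (-α * (1 / 4))))
    {f : ℝ → ℝ} {φ : Esp d → ℝ} {u : Esp d × ℝ → ℝ} (hf0 : f 0 = θ)
    (hfl : ∀ s t : ℝ, 0 ≤ s → 0 ≤ t → |f s - f t| ≤ δ * |s - t|)
    (hφ0 : φ 0 = 0) (hφ1 : fderiv ℝ φ 0 = 0)
    (hφd : ∀ x : Esp d, ‖x‖ < 1 → DifferentiableAt ℝ φ x)
    (hφl : ∀ x y : Esp d, ‖x‖ < 1 → ‖y‖ < 1 → ‖fderiv ℝ φ x - fderiv ℝ φ y‖ ≤ δ * ‖x - y‖)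
    (huc : ContinuousOn u {p : Esp d × ℝ | ‖p.1‖ < 1 ∧ 0 ≤ p.2 ∧ p.2 < 1})
    (huh : HarmonicOnH d u (openCyl d 1))
    (hun : ∀ x : Esp d, ‖x‖ < 1 → ∃ L : ℝ, NormalDeriv d u x L ∧ |L| ≤ θ ∧
        (u (x, 0) ≠ φ x → L = f |u (x, 0) - φ x| * Real.sign (u (x, 0) - φ x)))
    (huδ : ∀ x : Esp d, ‖x‖ < 1 → u (x, 0) ≤ δ)
    (hlow : ∀ p : Esp d × ℝ, ‖p.1‖ < 1 → 0 ≤ p.2 → p.2 < 1 → -(2 * δ) ≤ θ * p.2 - u p)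
    {z : Esp d} (hz : ‖z‖ < 1 / 100)
    (hcV : ∀ p, distSq d (z, 2 / 5) p ≤ (1 / 20) ^ 2 → c ≤ θ * p.2 - u p) :
    u (z, 0) ≤ φ z := by
  by_contra! hz0
  have hα0 : 0 < α := by rw [hα]; positivity
  have hz1 : ‖z‖ < 1 := by linarith
  have hφsmall : ∀ x : Esp d, ‖x‖ < 1 → |φ x| ≤ δ := fun x hx => by
    have h := abs_sub_sub_fderiv_le hδ.le hφd hφl hx (z := 0) (by simp)
    simp only [hφ0, hφ1, sub_zero, zero_apply] at h
    nlinarith [norm_nonneg x, mul_nonneg hδ.le (norm_nonneg x)]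
  have hDφ : ‖fderiv ℝ φ z‖ ≤ δ := by
    have h := hφl z 0 hz1 (by simp)
    simp only [hφ1, sub_zero] at h
    nlinarith [norm_nonneg z]
  set P : Esp d × ℝ := (z, 2 / 5) with hP
  set b : Esp d × ℝ → ℝ := fun q => Real.exp (-α * distSq d P q) with hb
  have hbC : ContDiff ℝ 2 b := (contDiff_const.mul (contDiff_distSq P)).exp
  have hmono : ∀ x y : ℝ, x ≤ y → Real.exp (-α * y) ≤ Real.exp (-α * x) := fun x y hxy =>
    Real.exp_le_exp.2 (by nlinarith)
  set A : (Esp d × ℝ) →L[ℝ] ℝ := θ • ContinuousLinearMap.snd ℝ (Esp d) ℝ +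
    (fderiv ℝ φ z).comp (ContinuousLinearMap.fst ℝ (Esp d) ℝ) with hA
  set k : ℝ := φ z - fderiv ℝ φ z z with hk
  set G : Esp d × ℝ → ℝ := fun q => ((A q + k) - u q) - c / 2 * b q with hG
  have hGeq : ∀ q, G q = (θ * q.2 - u q) + (φ z + fderiv ℝ φ z (q.1 - z)) - c / 2 * b q := by
    intro q
    simp [hG, hA, hk]
    ring
  have hdz : ∀ y : ℝ, distSq d P (z, y) = (y - 2 / 5) ^ 2 := fun y => by simp [hP, distSq]
  set K : Set (Esp d × ℝ) :=
    {q | (distSq d P q ≤ (1 / 2) ^ 2 ∧ (1 / 20) ^ 2 ≤ distSq d P q) ∧ 0 ≤ q.2} with hK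
  set U : Set (Esp d × ℝ) :=
    {q | (distSq d P q < (1 / 2) ^ 2 ∧ (1 / 20) ^ 2 < distSq d P q) ∧ 0 < q.2} with hU
  have hdc := (contDiff_distSq P).continuous
  have hKin : ∀ q ∈ K, ‖q.1 - z‖ ≤ 1 / 2 ∧ ‖q.1‖ < 1 ∧ q.2 < 1 := by
    intro q hq
    obtain ⟨h1, h2⟩ := norm_fst_sub_le_of_distSq_le (by norm_num) hq.1.1
    have h3 := norm_le_norm_add_norm_sub' q.1 z
    have h4 := (abs_le.1 h2).2
    simp only [hP] at h1 h4
    exact ⟨h1, by linarith, by linarith⟩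
  have huC : ∀ q ∈ U, q ∈ openCyl d 1 ∧ ContDiffAt ℝ 2 u q := fun q hq => by
    have h := hKin q ⟨⟨hq.1.1.le, hq.1.2.le⟩, hq.2.le⟩
    have hq' : q ∈ openCyl d 1 := ⟨h.2.1, hq.2, h.2.2⟩
    exact ⟨hq', huh.1.contDiffAt ((isOpen_openCyl 1).mem_nhds hq')⟩
  have hAC : ContDiff ℝ 2 fun q => A q + k := A.contDiff.add contDiff_const
  have hcb : ContDiff ℝ 2 fun q => c / 2 * b q := contDiff_const.mul hbC
  have hzK : (z, (0 : ℝ)) ∈ K := by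
    simp only [hK, mem_ofPred_eq, hdz]
    norm_num
  obtain ⟨q, hqK, hqU, hmin⟩ := exists_isMinOn_notMem_of_lapH_neg (K := K) (U := U) (G := G)
    (((isCompact_distSq_le P (1 / 2)).inter_right (isClosed_le continuous_const hdc)).inter_right
      (isClosed_le continuous_const continuous_snd))
    (((isOpen_lt hdc continuous_const).inter (isOpen_lt continuous_const hdc)).inter
      (isOpen_lt continuous_const continuous_snd))
    (fun q hq => ⟨⟨hq.1.1.le, hq.1.2.le⟩, hq.2.le⟩)
    ((hAC.continuous.continuousOn.sub (huc.mono fun q hq =>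
      ⟨(hKin q hq).2.1, hq.2, (hKin q hq).2.2⟩)).sub hcb.continuous.continuousOn)
    (fun q hq => (hAC.contDiffAt.sub (huC q hq).2).sub hcb.contDiffAt)
    (fun q hq => by
      have h := lapH_exp_distSq_pos (by norm_num) hq.1.2
      rw [← hα] at h
      rw [hG, lapH_sub (hAC.contDiffAt.sub (huC q hq).2) hcb.contDiffAt,
        lapH_sub hAC.contDiffAt (huC q hq).2, lapH_add A.contDiff.contDiffAt contDiff_const.contDiffAt,
        lapH_clm, lapH_const, huh.2 q (huC q hq).1, lapH_const_mul]
      have := mul_pos (half_pos hc) h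
      linarith) ⟨_, hzK⟩
  set b0 : ℝ := Real.exp (-α * (4 / 25)) with hb0
  have hqz : G q < -(c / 2 * b0) := by
    refine (hmin hzK).trans_lt ?_
    have : b (z, 0) = b0 := by simp only [hb, hdz, hb0]; norm_num
    rw [hGeq, this]
    simp
    linarith
  obtain ⟨hq1, hq2, hq3⟩ := hKin q hqK
  have hℓ : -(2 * δ) ≤ φ z + fderiv ℝ φ z (q.1 - z) := by
    have h1 := (abs_le.1 (hφsmall z hz1)).1
    have h2 := (abs_le.1 ((fderiv ℝ φ z).le_opNorm (q.1 - z))).1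
    nlinarith [norm_nonneg (fderiv ℝ φ z), norm_nonneg (q.1 - z)]
  have hVq := hlow q hq2 hqK.2 hq3
  rw [mul_sub] at hδ2
  have he4 := Real.exp_pos (-α * (1 / 4))
  have hb01 : b0 ≤ 1 := by rw [hb0, Real.exp_le_one_iff]; nlinarith
  have hb00 : 0 < b0 := Real.exp_pos _
  have hq4 : distSq d P q < (1 / 2) ^ 2 := by
    by_contra! h
    have h1 : b q ≤ Real.exp (-α * (1 / 4)) := hmono _ _ (by linarith)
    have h2 : c / 2 * b q ≤ c / 2 * Real.exp (-α * (1 / 4)) := by gcongr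
    rw [hGeq] at hqz
    linarith
  have hq5 : (1 / 20) ^ 2 < distSq d P q := by
    by_contra! h
    have h1 := hcV q h
    have h2 : b q ≤ 1 := by
      simp only [hb]; rw [Real.exp_le_one_iff]; nlinarith [distSq_nonneg P q]
    have h3 : c / 2 * b q ≤ c / 2 * 1 := by gcongr
    have h4 : c / 2 * b0 ≤ c / 2 * 1 := by gcongr
    have h5 : 0 < c / 2 * Real.exp (-α * (1 / 4)) := by positivity
    have h6 : 0 < c / 2 * b0 := by positivity
    rw [hGeq] at hqz
    linarith
  have hq0 : q.2 = 0 := le_antisymm (not_lt.1 fun h => hqU ⟨⟨hq4, hq5⟩, h⟩) hqK.2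
  obtain ⟨x, y⟩ := q
  simp only at hq0
  subst hq0
  simp only at hq1 hq2 hq3 hℓ hVq
  have hdx : distSq d P (x, 0) = ‖x - z‖ ^ 2 + 4 / 25 := by
    simp only [distSq, hP]; norm_num
  have hs : ‖x - z‖ ^ 2 < 9 / 100 := by rw [hdx] at hq4; linarith
  rcases le_or_gt (u (x, 0)) (φ x) with hle | hgt
  · have ht := (abs_le.1 (abs_sub_sub_fderiv_le hδ.le hφd hφl hq2 hz1)).2
    have hbx : b (x, 0) = b0 * Real.exp (-(α * ‖x - z‖ ^ 2)) := by
      simp only [hb, hdx, hb0, ← Real.exp_add]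
      congr 1; ring
    have h1 : (1 + α * ‖x - z‖ ^ 2) * Real.exp (-(α * ‖x - z‖ ^ 2)) ≤ 1 := by
      rw [Real.exp_neg, mul_inv_le_iff₀ (Real.exp_pos _), one_mul]
      linarith [Real.add_one_le_exp (α * ‖x - z‖ ^ 2)]
    have h2 : Real.exp (-α * (1 / 4)) ≤ b0 * Real.exp (-(α * ‖x - z‖ ^ 2)) := by
      rw [← hbx]
      exact hmono _ _ (by rw [hdx]; linarith)
    rw [hGeq, hbx] at hqz
    simp only [mul_zero, zero_sub] at hqz
    have h3 : b0 * Real.exp (-(α * ‖x - z‖ ^ 2)) +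
        α * ‖x - z‖ ^ 2 * Real.exp (-α * (1 / 4)) ≤ b0 := by
      have : α * ‖x - z‖ ^ 2 * Real.exp (-α * (1 / 4)) ≤
        α * ‖x - z‖ ^ 2 * (b0 * Real.exp (-(α * ‖x - z‖ ^ 2))) := by gcongr
      nlinarith
    have h4 : δ * ‖x - z‖ ^ 2 ≤ c / 2 * (α * ‖x - z‖ ^ 2 * Real.exp (-α * (1 / 4))) := by
      nlinarith [sq_nonneg ‖x - z‖]
    nlinarith
  · obtain ⟨L, hL, -, hL2⟩ := hun x hq2
    have hLeq := hL2 hgt.ne'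
    rw [Real.sign_of_pos (sub_pos.2 hgt), mul_one, abs_of_pos (sub_pos.2 hgt)] at hLeq
    have hLlow : θ - δ * (2 * δ) ≤ L := by
      have h1 := (abs_le.1 (hfl (u (x, 0) - φ x) 0 (sub_pos.2 hgt).le le_rfl)).1
      rw [hf0, sub_zero, abs_of_pos (sub_pos.2 hgt), ← hLeq] at h1
      have h2 := huδ x hq2
      have h3 := (abs_le.1 (hφsmall x hq2)).1
      nlinarith
    have hbd : HasDerivAt (fun t : ℝ => b (x, t)) (b (x, 0) * (α * (4 / 5))) 0 := by
      have h1 : HasDerivAt (fun t : ℝ => -α * distSq d P (x, t)) (α * (4 / 5)) 0 := by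
        have := ((((hasDerivAt_id (0 : ℝ)).sub_const (2 / 5)).pow 2).const_add
          (‖x - z‖ ^ 2)).const_mul (-α)
        refine HasDerivAt.congr_deriv (this.congr_of_eventuallyEq ?_) ?_
        · exact Filter.Eventually.of_forall fun t => by simp [distSq, hP]
        · simp only [id_eq, Nat.cast_ofNat, Nat.add_one_sub_one, pow_one]; ring
      exact h1.exp
    have hIoi : nhdsWithin (0 : ℝ) (Ioi 0) ≤ nhdsWithin 0 {0}ᶜ :=
      nhdsWithin_mono 0 fun t ht => (mem_Ioi.1 ht).ne'
    have hlim := ((hasDerivAt_iff_tendsto_slope_zero.1 hbd).mono_left hIoi).const_mul (c / 2)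
    have hlim2 := (hL.const_sub θ).sub hlim
    have hev : ∀ᶠ t in nhdsWithin (0 : ℝ) (Ioi 0), (x, t) ∈ K := by
      have hcont : Continuous fun t : ℝ => distSq d P (x, t) :=
        hdc.comp (by fun_prop)
      have h1 := hcont.continuousAt.eventually_lt_const hq4
      have h2 := hcont.continuousAt.eventually_const_lt hq5
      filter_upwards [nhdsWithin_le_nhds h1, nhdsWithin_le_nhds h2, self_mem_nhdsWithin]
        with t h1 h2 h3 using ⟨⟨h1.le, h2.le⟩, (mem_Ioi.1 h3).le⟩
    have hge := ge_of_tendsto hlim2 (b := 0) (by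
      filter_upwards [hev, self_mem_nhdsWithin] with t ht ht0
      have h1 : G (x, 0) ≤ G (x, t) := hmin ht
      rw [hGeq, hGeq] at h1
      simp only [mul_zero, zero_sub] at h1
      have ht0' : 0 < t := ht0
      have h2 : θ - (u (x, t) - u (x, 0)) / t - c / 2 * (t⁻¹ • (b (x, 0 + t) - b (x, 0))) =
          (θ * t - (u (x, t) - u (x, 0)) - c / 2 * (b (x, t) - b (x, 0))) / t := by
        rw [zero_add, smul_eq_mul]; field_simp
      rw [h2]
      exact div_nonneg (by linarith) ht0'.le)
    have hbx : Real.exp (-α * (1 / 4)) ≤ b (x, 0) := hmono _ _ (by linarith)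
    have h5 : c / 2 * (α * Real.exp (-α * (1 / 4))) ≤ c / 2 * (α * b (x, 0)) := by gcongr
    nlinarith

/-- If `∂_y u` is small at one interior point, then `θ y - u` is bounded below on a ball. -/
theorem le_on_ball_of_pdy_lt {θ δ r : ℝ} (hr0 : 0 < r)
    (hrD : r * (100 * ((d + 1) * (d + 2))) = 1) (hr1 : r ≤ 1 / 200) (hθ : 0 < θ) (hδ : 0 < δ)
    (hδθ : δ ≤ θ) (hδr : 3 * δ ≤ r * θ / 4) {u : Esp d × ℝ → ℝ}
    (huc : ContinuousOn u {p : Esp d × ℝ | ‖p.1‖ < 1 ∧ 0 ≤ p.2 ∧ p.2 < 1})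
    (huh : HarmonicOnH d u (openCyl d 1))
    (hpd : ∀ p ∈ openCyl d 1, |pdy d u p| ≤ θ + δ)
    (hlow : ∀ p : Esp d × ℝ, ‖p.1‖ < 1 → 0 ≤ p.2 → p.2 < 1 → -(2 * δ) ≤ θ * p.2 - u p)
    {x₀ : Esp d} (hx₀ : ‖x₀‖ ≤ 1 / 2) (hcon : pdy d u (x₀, 1 / 2) < θ / 2)
    {p : Esp d × ℝ} (hp : distSq d (x₀, 1 / 2 + 2 * r) p ≤ r ^ 2) :
    r * θ / 4 ≤ θ * p.2 - u p := by
  have hpdr : ∀ p : Esp d × ℝ, ‖p - (x₀, 1 / 2)‖ ≤ r → pdy d u p ≤ 3 / 4 * θ := by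
    intro p hp
    have h1 := (abs_le.1 (abs_pdy_sub_le huh (M := 2 * θ) (by positivity)
      (fun p hp => (hpd p hp).trans (by linarith)) hx₀ (hp.trans (by linarith)))).2
    have h2 : ((d : ℝ) + 1) * (2 * θ / (3 / 10) * (d + 2)) * ‖p - (x₀, 1 / 2)‖ ≤ θ / 4 := by
      calc ((d : ℝ) + 1) * (2 * θ / (3 / 10) * (d + 2)) * ‖p - (x₀, 1 / 2)‖
          ≤ ((d : ℝ) + 1) * (2 * θ / (3 / 10) * (d + 2)) * r := by gcongr
        _ = 2 * θ / (3 / 10) / 100 * (r * (100 * ((d + 1) * (d + 2)))) := by ring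
        _ ≤ θ / 4 := by rw [hrD]; linarith
    linarith
  obtain ⟨x, y⟩ := p
  obtain ⟨h1, h2⟩ := norm_fst_sub_le_of_distSq_le hr0.le hp
  simp only at h1 h2
  have h3 := abs_le.1 h2
  have hx : ‖x‖ < 1 := by linarith [norm_le_norm_add_norm_sub' x x₀]
  have e1 := hlow (x, 1 / 2 - r) hx (by simp only; linarith) (by simp only; linarith)
  have e2 := vertical_sub_le_of_pdy_le huc huh (x := x) (a := 1 / 2 - r) (b := 1 / 2 + r)
    (C := 3 / 4 * θ) hx (by linarith) (by linarith) (by linarith) fun s hs => hpdr _ (by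
      rw [Prod.norm_def]
      exact max_le h1 (abs_le.2 ⟨by simp only [Prod.snd_sub]; linarith [hs.1],
        by simp only [Prod.snd_sub]; linarith [hs.2]⟩))
  have e3 := vertical_sub_le_of_pdy_le huc huh (x := x) (a := 1 / 2 + r) (b := y) hx (by linarith)
    (by linarith) (by linarith) fun s hs =>
      (abs_le.1 (hpd (x, s) ⟨hx, by linarith [hs.1], by linarith [hs.2]⟩)).2
  simp only at e1 ⊢
  have h4 : δ * (y - (1 / 2 + r)) ≤ δ * (2 * r) := by
    gcongr
    linarith
  have h5 : δ * (2 * r) ≤ δ * 1 := by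
    gcongr
    linarith
  linarith

/-- Positivity on a small ball around `(x₀, 1 / 2 + 2 * r)` propagates to a ball around `(z, 2 / 5)`. -/
theorem le_on_ball_of_le_on_ball {r δ c₁ c₂ c₃ : ℝ} (hr0 : 0 < r) (hr1 : r ≤ 1 / 200)
    (hδ : 0 < δ) (hc₁0 : 0 < c₁) (hc₂0 : 0 < c₂)
    (hc₂ : c₂ + 2 * δ ≤ c₁ * (Real.exp (-((d + 1) / r ^ 2) * (2 / 5) ^ 2) -
      Real.exp (-((d + 1) / r ^ 2) * (9 / 20) ^ 2)))
    (hc₃ : c₃ + 2 * δ ≤ c₂ * (Real.exp (-((d + 1) / (1 / 10) ^ 2) * (2 / 5) ^ 2) -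
      Real.exp (-((d + 1) / (1 / 10) ^ 2) * (9 / 20) ^ 2)))
    {V : Esp d × ℝ → ℝ} (hVH : HarmonicOnH d V (openCyl d 1))
    (hVlow : ∀ p ∈ openCyl d 1, -(2 * δ) ≤ V p) {x₀ z : Esp d} (hx₀ : ‖x₀‖ ≤ 1 / 2)
    (hz : ‖z‖ < 1 / 100) (hV : ∀ p, distSq d (x₀, 1 / 2 + 2 * r) p ≤ r ^ 2 → c₁ ≤ V p)
    {p : Esp d × ℝ} (hp : distSq d (z, 2 / 5) p ≤ (1 / 20) ^ 2) : c₃ ≤ V p := by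
  have hV₂ : ∀ p, distSq d ((1 / 2 : ℝ) • x₀, 1 / 2) p ≤ (1 / 10) ^ 2 → c₂ ≤ V p := by
    rintro ⟨x, y⟩ hp
    obtain ⟨h1, h2⟩ := norm_fst_sub_le_of_distSq_le (by norm_num) hp
    simp only at h1 h2
    have h3 := abs_le.1 h2
    have h4 : ‖x - x₀‖ ≤ 7 / 20 := by
      have : x - x₀ = (x - (1 / 2 : ℝ) • x₀) - (1 / 2 : ℝ) • x₀ := by module
      rw [this]
      refine (norm_sub_le _ _).trans ?_
      rw [norm_smul, Real.norm_of_nonneg (by norm_num)]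
      linarith
    have hin : ∀ p, distSq d (x₀, 1 / 2 + 2 * r) p ≤ (9 / 20) ^ 2 → p ∈ openCyl d 1 :=
      fun p hp => mem_openCyl_of_distSq_le (by norm_num) hp (by simp only; linarith)
        (by simp only; linarith) (by simp only; linarith)
    have := le_of_harmonicOnH_of_le_on_ball (isOpen_openCyl 1) hVH (P := (x₀, 1 / 2 + 2 * r))
      (R := 9 / 20) (R' := 2 / 5) hr0 hc₁0 (by positivity : 0 ≤ 2 * δ) (by norm_num) (by norm_num)
      hin (fun p hp => hVlow p (hin p hp)) hV (p := (x, y)) (by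
          simp only [distSq]
          nlinarith [norm_nonneg (x - x₀)])
    linarith
  obtain ⟨x, y⟩ := p
  obtain ⟨h1, h2⟩ := norm_fst_sub_le_of_distSq_le (by norm_num) hp
  simp only at h1 h2
  have h3 := abs_le.1 h2
  have hx₁ : ‖(1 / 2 : ℝ) • x₀‖ ≤ 1 / 4 := by
    rw [norm_smul, Real.norm_of_nonneg (by norm_num)]
    linarith
  have h4 : ‖x - (1 / 2 : ℝ) • x₀‖ ≤ 31 / 100 := by
    have : x - (1 / 2 : ℝ) • x₀ = (x - z) + z - (1 / 2 : ℝ) • x₀ := by module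
    rw [this]
    refine (norm_sub_le _ _).trans ?_
    linarith [norm_add_le (x - z) z]
  have hin : ∀ p, distSq d ((1 / 2 : ℝ) • x₀, 1 / 2) p ≤ (9 / 20) ^ 2 → p ∈ openCyl d 1 :=
    fun p hp => mem_openCyl_of_distSq_le (by norm_num) hp (by simp only; linarith)
      (by norm_num) (by norm_num)
  have := le_of_harmonicOnH_of_le_on_ball (isOpen_openCyl 1) hVH
    (P := ((1 / 2 : ℝ) • x₀, 1 / 2)) (r := 1 / 10)
    (R := 9 / 20) (R' := 2 / 5) (by norm_num) hc₂0 (by positivity : 0 ≤ 2 * δ) (by norm_num)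
    (by norm_num) hin (fun p hp => hVlow p (hin p hp)) hV₂ (p := (x, y)) (by
        simp only [distSq]
        nlinarith [norm_nonneg (x - (1 / 2 : ℝ) • x₀)])
  linarith

theorem exists_pos_forall_four_mul_le {s : Finset ℝ} (hs : ∀ a ∈ s, 0 < a) :
    ∃ δ > 0, ∀ a ∈ s, 4 * δ ≤ a := by
  have h : ∀ᶠ δ in nhdsWithin (0 : ℝ) (Ioi 0), ∀ a ∈ s, 4 * δ ≤ a := by
    rw [Filter.eventually_all_finset]
    intro a ha
    filter_upwards [Ioo_mem_nhdsGT (div_pos (hs a ha) four_pos)] with δ h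
    linarith [h.2]
  obtain ⟨δ, h1, h2⟩ := (eventually_mem_nhdsWithin.and h).exists
  exact ⟨δ, h1, h2⟩

end

/-- **barrier lemma.** There are `δ, η > 0`, depending only on `d` and `θ`,
such that: whenever `f` has Lipschitz constant at most `δ` with `f ≤ f 0 = θ`, `φ` is
`C^{1,1}` on `B₁'` with `φ(0) = 0`, `∇φ(0) = 0` and gradient-Lipschitz constant at most
`δ`, `u` is continuous on `B₁' × [0,1)`, harmonic inside, solves the two-phase boundary
condition on `B₁'`, satisfies `u(·,0) ≤ δ` on `B₁'` and `|∂_y u| ≤ θ + δy` on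
`B₁' × (0,1)`, and `u(ẑ,0) > φ(ẑ)` at some `ẑ ∈ B'_{1/100}`, then `∂_y u ≥ θ/2` on
`{y = η, |x| ≤ 1/2}`. -/
theorem statement17
    (d : ℕ) (hd : 1 ≤ d) (θ : ℝ) (hθ : 0 < θ) :
    ∃ δ > 0, ∃ η > 0, ∀ (f : ℝ → ℝ) (φ : Esp d → ℝ) (u : Esp d × ℝ → ℝ),
      f 0 = θ →
      (∀ s : ℝ, 0 ≤ s → 0 < f s ∧ f s ≤ θ) →
      (∀ s t : ℝ, 0 ≤ s → 0 ≤ t → |f s - f t| ≤ δ * |s - t|) →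
      φ 0 = 0 → fderiv ℝ φ 0 = 0 →
      (∀ x : Esp d, ‖x‖ < 1 → DifferentiableAt ℝ φ x) →
      (∀ x y : Esp d, ‖x‖ < 1 → ‖y‖ < 1 → ‖fderiv ℝ φ x - fderiv ℝ φ y‖ ≤ δ * ‖x - y‖) →
      ContinuousOn u {p : Esp d × ℝ | ‖p.1‖ < 1 ∧ 0 ≤ p.2 ∧ p.2 < 1} →
      HarmonicOnH d u {p : Esp d × ℝ | ‖p.1‖ < 1 ∧ 0 < p.2 ∧ p.2 < 1} →
      (∀ x : Esp d, ‖x‖ < 1 → ∃ L : ℝ, NormalDeriv d u x L ∧ |L| ≤ θ ∧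
        (u (x, 0) ≠ φ x → L = f |u (x, 0) - φ x| * Real.sign (u (x, 0) - φ x))) →
      (∀ x : Esp d, ‖x‖ < 1 → u (x, 0) ≤ δ) →
      (∀ p : Esp d × ℝ, ‖p.1‖ < 1 → 0 < p.2 → p.2 < 1 → |pdy d u p| ≤ θ + δ * p.2) →
      (∃ z : Esp d, ‖z‖ < 1/100 ∧ φ z < u (z, 0)) →
      ∀ x : Esp d, ‖x‖ ≤ 1/2 → θ/2 ≤ pdy d u (x, η) := by
  set r : ℝ := 1 / (100 * ((d + 1) * (d + 2))) with hr
  have hD : (2 : ℝ) ≤ (d + 1) * (d + 2) := by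
    have : (0 : ℝ) ≤ d := d.cast_nonneg
    nlinarith
  have hr0 : 0 < r := by positivity
  have hrD : r * (100 * ((d + 1) * (d + 2))) = 1 := by rw [hr]; field_simp
  have hr1 : r ≤ 1 / 200 := by nlinarith
  clear_value r
  have hexp : ∀ {α x y : ℝ}, 0 < α → x < y → 0 < Real.exp (-α * x) - Real.exp (-α * y) :=
    fun hα hxy => sub_pos.2 (Real.exp_lt_exp.2 (by nlinarith))
  have hα : ∀ {s : ℝ}, 0 < s → (0 : ℝ) < (d + 1) / s ^ 2 := fun hs => by positivity
  have hc₁0 : 0 < r * θ / 4 := by positivity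
  obtain ⟨c₂, hc₂0, hc₂⟩ := exists_between (mul_pos hc₁0
    (hexp (x := (2 / 5) ^ 2) (y := (9 / 20) ^ 2) (hα hr0) (by norm_num)))
  obtain ⟨c₃, hc₃0, hc₃⟩ := exists_between (mul_pos hc₂0
    (hexp (x := (2 / 5) ^ 2) (y := (9 / 20) ^ 2) (hα (s := 1 / 10) (by norm_num)) (by norm_num)))
  obtain ⟨α, hαdef⟩ : ∃ α : ℝ, α = (d + 1) / (1 / 20) ^ 2 := ⟨_, rfl⟩
  have hα0 : 0 < α := hαdef ▸ hα (by norm_num)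
  have hε₁ := mul_pos (half_pos hc₃0) (hexp (x := 4 / 25) (y := 1 / 4) hα0 (by norm_num))
  have hε₂ : 0 < c₃ / 2 * (α * Real.exp (-α * (1 / 4))) := by positivity
  obtain ⟨δ, hδ, hδa⟩ := exists_pos_forall_four_mul_le (s := {θ, 1, r * θ / 4, _, _, _, _})
    (by simpa only [Finset.forall_mem_insert, Finset.mem_singleton, forall_eq] using
      ⟨hθ, one_pos, hc₁0, sub_pos.2 hc₂, sub_pos.2 hc₃, hε₁, hε₂⟩)
  simp only [Finset.forall_mem_insert, Finset.mem_singleton, forall_eq] at hδa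
  obtain ⟨hδθ, hδ1, hδc₁, hδc₂, hδc₃, hδε₁, hδε₂⟩ := hδa
  refine ⟨δ, hδ, 1 / 2, by norm_num, ?_⟩
  rintro f φ u hf0 - hfl hφ0 hφ1 hφd hφl huc huh hun huδ hupd ⟨z, hz, huz⟩ x₀ hx₀
  by_contra! hcon
  have huH : HarmonicOnH d u (openCyl d 1) := huh
  have hpd : ∀ p ∈ openCyl d 1, |pdy d u p| ≤ θ + δ := fun p hp =>
    (hupd p hp.1 hp.2.1 hp.2.2).trans (by nlinarith [hp.2.2])
  have hlow : ∀ p : Esp d × ℝ, ‖p.1‖ < 1 → 0 ≤ p.2 → p.2 < 1 → -(2 * δ) ≤ θ * p.2 - u p := by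
    rintro ⟨x, y⟩ h1 h2 h3
    have h4 := vertical_sub_le_of_pdy_le huc huH h1 le_rfl h2 h3 fun s hs =>
      (abs_le.1 (hpd (x, s) ⟨h1, hs.1, hs.2.trans h3⟩)).2
    have h5 := huδ x h1
    simp only at h1 h2 h3 h4 ⊢
    nlinarith
  have hVH : HarmonicOnH d (fun p => θ * p.2 - u p) (openCyl d 1) := by
    have hlin : ContDiff ℝ 2 fun p : Esp d × ℝ => θ * p.2 := by fun_prop
    refine ⟨hlin.contDiffOn.sub huH.1, fun p hp => ?_⟩
    have := lapH_clm (θ • ContinuousLinearMap.snd ℝ (Esp d) ℝ) p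
    rw [lapH_sub hlin.contDiffAt (huH.1.contDiffAt ((isOpen_openCyl 1).mem_nhds hp)), huH.2 p hp,
      sub_zero]
    exact this
  refine huz.not_ge (le_obstacle_of_le_on_ball hαdef hc₃0 hδ (by linarith) hδε₁ (by linarith) hf0
    hfl hφ0 hφ1 hφd hφl huc huH hun huδ hlow hz fun p hp => ?_)
  exact le_on_ball_of_le_on_ball hr0 hr1 hδ hc₁0 hc₂0 (by linarith) (by linarith) hVH
    (fun p hp => hlow p hp.1 hp.2.1.le hp.2.2) hx₀ hz
    (fun p hp => le_on_ball_of_pdy_lt hr0 hrD hr1 hθ hδ (by linarith) (by linarith) huc huH hpd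
      hlow hx₀ hcon hp) hp
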